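/- arXiv:1309.0028 — 11 statements merged into one kernel-verified Lean document; each statement's English description precedes it below -/
import Mathlib

section
/- The formula φ_{(v',z')}(t,v,z) = (t, v − R(t)v', z − z' − ½ vᵀ J R(t) v') defines a left action of the Heisenberg group H₃(ℝ) on ℝ⁴; that is, φ_{(0,0)} is the identity map of ℝ⁴ and φ_{h₁·h₂} = φ_{h₁} ∘ φ_{h₂} for all h₁, h₂ ∈ H₃(ℝ). -/
noncomputable section

/-- Points of `ℝ⁴`, written `(t, v, z)` with `t z : ℝ`, `v : ℝ × ℝ`. -/
abbrev P : Type := ℝ × (ℝ × ℝ) × ℝ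

/-- The rotation `R(t)` acting on `ℝ²`. -/
def Rot (t : ℝ) (v : ℝ × ℝ) : ℝ × ℝ :=
  (Real.cos t * v.1 - Real.sin t * v.2, Real.sin t * v.1 + Real.cos t * v.2)

/-- `vᵀ J w` for `J = [[0,1],[-1,0]]`. -/
def omegaJ (v w : ℝ × ℝ) : ℝ := v.1 * w.2 - v.2 * w.1

/-- The Lorentzian metric `g` at the point `p = (t,(x,y),z)`, with matrix
`[[0, y/2, −x/2, 1],[y/2, 1, 0, 0],[−x/2, 0, 1, 0],[1, 0, 0, 0]]`. -/
def gmet (p u w : P) : ℝ :=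
  u.2.1.1 * w.2.1.1 + u.2.1.2 * w.2.1.2 + (u.1 * w.2.2 + u.2.2 * w.1)
    + (p.2.1.2 / 2) * (u.1 * w.2.1.1 + u.2.1.1 * w.1)
    - (p.2.1.1 / 2) * (u.1 * w.2.1.2 + u.2.1.2 * w.1)

/-- `φ` is an isometry of `g`: a differentiable bijection whose differential
preserves `g` at every point. -/
def IsIsometry (φ : P → P) : Prop :=
  Differentiable ℝ φ ∧ Function.Bijective φ ∧
    ∀ p u w : P, gmet (φ p) (fderiv ℝ φ p u) (fderiv ℝ φ p w) = gmet p u w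

/-- Multiplication of the oscillator group `G`. -/
def mulG (a b : P) : P :=
  (a.1 + b.1, a.2.1 + Rot a.1 b.2.1,
   a.2.2 + b.2.2 + (1 / 2) * omegaJ a.2.1 (Rot a.1 b.2.1))

/-- Multiplication of the nilpotent group `N = ℝ × H₃(ℝ)`. -/
def mulN (a b : P) : P :=
  (a.1 + b.1, a.2.1 + b.2.1, a.2.2 + b.2.2 + (1 / 2) * omegaJ a.2.1 b.2.1)

/-- Inversion in the oscillator group `G`. -/
def invG (a : P) : P := (-a.1, -Rot (-a.1) a.2.1, -a.2.2)

/-- Multiplication of the Heisenberg group `H₃(ℝ)` on `ℝ² × ℝ`. -/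
def mulH (a b : (ℝ × ℝ) × ℝ) : (ℝ × ℝ) × ℝ :=
  (a.1 + b.1, a.2 + b.2 + (1 / 2) * omegaJ a.1 b.1)

/-- The map `φ_{(v',z')}(t,v,z) = (t, v − R(t)v', z − z' − ½ vᵀ J R(t) v')`. -/
def phiH (h : (ℝ × ℝ) × ℝ) (p : P) : P :=
  (p.1, p.2.1 - Rot p.1 h.1, p.2.2 - h.2 - (1 / 2) * omegaJ p.2.1 (Rot p.1 h.1))

/-- The one-parameter subgroups (geodesics through the identity) of `G`. -/
def alphaG (X : P) (s : ℝ) : P :=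
  if X.1 = 0 then (0, (X.2.1.1 * s, X.2.1.2 * s), X.2.2 * s)
  else
    (X.1 * s,
     ((X.2.1.1 / X.1) * Real.sin (X.1 * s) + (X.2.1.2 / X.1) * Real.cos (X.1 * s)
        - X.2.1.2 / X.1,
      -(X.2.1.1 / X.1) * Real.cos (X.1 * s) + (X.2.1.2 / X.1) * Real.sin (X.1 * s)
        + X.2.1.1 / X.1),
     (1 / 2) * (((X.2.1.1 ^ 2 + X.2.1.2 ^ 2) / X.1 + 2 * X.2.2) * s
        - ((X.2.1.1 ^ 2 + X.2.1.2 ^ 2) / X.1 ^ 2) * Real.sin (X.1 * s)))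

/-- The lattice `θℤ × ℤ × ℤ × (1/(2k))ℤ` of `G`. -/
def Lam (θ : ℝ) (k : ℕ) : Set P :=
  {p | (∃ m : ℤ, p.1 = θ * m) ∧ (∃ m : ℤ, p.2.1.1 = m) ∧ (∃ m : ℤ, p.2.1.2 = m)
     ∧ ∃ m : ℤ, p.2.2 = m / (2 * k)}

/-- `Λ` is a subgroup of the oscillator group `G`. -/
def IsSubgroupG (Λ : Set P) : Prop :=
  ((0, (0, 0), 0) : P) ∈ Λ ∧ (∀ a ∈ Λ, ∀ b ∈ Λ, mulG a b ∈ Λ) ∧ ∀ a ∈ Λ, invG a ∈ Λ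

/-- Conjugation `g x g⁻¹` in `G`. -/
def conjG (g x : P) : P := mulG (mulG g x) (invG g)

/-- Rotations are additive. -/
theorem Rot_add (t : ℝ) (v w : ℝ × ℝ) : Rot t (v + w) = Rot t v + Rot t w := by
  ext <;> simp only [Rot, Prod.fst_add, Prod.snd_add] <;> ring

/-- Rotations preserve the symplectic form `omegaJ`. -/
theorem omegaJ_Rot (t : ℝ) (v w : ℝ × ℝ) : omegaJ (Rot t v) (Rot t w) = omegaJ v w := by
  simp only [omegaJ, Rot]
  linear_combination (v.1 * w.2 - v.2 * w.1) * Real.sin_sq_add_cos_sq t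

theorem omegaJ_add_right (u v w : ℝ × ℝ) : omegaJ u (v + w) = omegaJ u v + omegaJ u w := by
  simp only [omegaJ, Prod.fst_add, Prod.snd_add]
  ring

theorem omegaJ_sub_left (u v w : ℝ × ℝ) : omegaJ (u - v) w = omegaJ u w - omegaJ v w := by
  simp only [omegaJ, Prod.fst_sub, Prod.snd_sub]
  ring

theorem omegaJ_swap (v w : ℝ × ℝ) : omegaJ w v = -omegaJ v w := by
  simp only [omegaJ]
  ring

/-- `φ` defines a left action of the Heisenberg group `H₃(ℝ)` on `ℝ⁴`:
`φ_{(0,0)} = id` and `φ_{h₁·h₂} = φ_{h₁} ∘ φ_{h₂}`. -/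
theorem heisenberg_phi_is_left_action :
    (∀ p : P, phiH ((0, 0), 0) p = p) ∧
    (∀ h₁ h₂ : (ℝ × ℝ) × ℝ, ∀ p : P, phiH (mulH h₁ h₂) p = phiH h₁ (phiH h₂ p)) := by
  refine ⟨fun p => by simp [phiH, Rot, omegaJ, ← Prod.zero_eq_mk], fun h₁ h₂ p => ?_⟩
  refine Prod.ext rfl (Prod.ext ?_ ?_)
  · simp only [phiH, mulH, Rot_add]
    abel
  · simp only [phiH, mulH, Rot_add, omegaJ_add_right, omegaJ_sub_left, omegaJ_Rot,
      omegaJ_swap h₁.1 h₂.1]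
    ring
end
end

section
/- For every (v',z') ∈ ℝ²×ℝ, the map φ_{(v',z')}: ℝ⁴ → ℝ⁴ given by φ_{(v',z')}(t,v,z) = (t, v − R(t)v', z − z' − ½ vᵀ J R(t) v') is an isometry of the Lorentzian metric g on ℝ⁴. -/
noncomputable section

theorem phiH_neg_leftInverse (h : (ℝ × ℝ) × ℝ) :
    Function.LeftInverse (phiH (-h)) (phiH h) := by
  rintro ⟨t, ⟨x, y⟩, z⟩
  ext <;> simp [phiH, Rot, omegaJ] <;> ring

theorem phiH_bijective (h : (ℝ × ℝ) × ℝ) : Function.Bijective (phiH h) :=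
  Function.bijective_iff_has_inverse.mpr ⟨phiH (-h), phiH_neg_leftInverse h, by
    simpa [Function.RightInverse] using phiH_neg_leftInverse (-h)⟩

theorem differentiable_phiH (h : (ℝ × ℝ) × ℝ) : Differentiable ℝ (phiH h) := by
  unfold phiH omegaJ Rot
  fun_prop

/-- The derivative of `t ↦ R(t) v` is `R(t) v` turned by a right angle. -/
theorem hasDerivAt_Rot (v : ℝ × ℝ) (t : ℝ) :
    HasDerivAt (fun s => Rot s v) (-(Rot t v).2, (Rot t v).1) t := by
  have hc := Real.hasDerivAt_cos t
  have hs := Real.hasDerivAt_sin t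
  refine HasDerivAt.congr_deriv (((hc.mul_const v.1).sub (hs.mul_const v.2)).prodMk
    ((hs.mul_const v.1).add (hc.mul_const v.2))) ?_
  ext <;> simp [Rot] <;> ring

theorem fderiv_phiH_apply (h : (ℝ × ℝ) × ℝ) (p u : P) :
    fderiv ℝ (phiH h) p u =
      (u.1, u.2.1 - u.1 • (-(Rot p.1 h.1).2, (Rot p.1 h.1).1),
        u.2.2 - (1 / 2) * (omegaJ u.2.1 (Rot p.1 h.1)
          + u.1 * omegaJ p.2.1 (-(Rot p.1 h.1).2, (Rot p.1 h.1).1))) := by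
  have ht := hasFDerivAt_fst (𝕜 := ℝ) (p := p)
  have hvz := hasFDerivAt_snd (𝕜 := ℝ) (p := p)
  have hv := hvz.fst
  have hz := hvz.snd
  have hr := (hasDerivAt_Rot h.1 p.1).hasFDerivAt.comp p ht
  have hω := (hv.fst.mul hr.snd).sub (hv.snd.mul hr.fst)
  have hφ : HasFDerivAt (phiH h) _ p :=
    ht.prodMk ((hv.sub hr).prodMk ((hz.sub_const h.2).sub (hω.const_mul (1 / 2))))
  rw [hφ.fderiv]
  ext <;> simp [omegaJ]
  ring

/-- for every `(v',z') ∈ ℝ² × ℝ`, the map `φ_{(v',z')}` is an isometry of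
the Lorentzian metric `g` on `ℝ⁴`. -/
theorem phiH_isometry (h : (ℝ × ℝ) × ℝ) : IsIsometry (phiH h) := by
  refine ⟨differentiable_phiH h, phiH_bijective h, fun p u w => ?_⟩
  simp only [fderiv_phiH_apply, gmet, phiH, omegaJ, Prod.fst_sub, Prod.snd_sub, Prod.smul_fst,
    Prod.smul_snd, smul_eq_mul]
  ring
end
end

section
/- The metric g is bi-invariant for the oscillator group structure but only left-invariant for the nilpotent group structure: for every h ∈ ℝ⁴ the right translation x ↦ x ·_G h is an isometry of g, whereas there exists h ∈ ℝ⁴ such that the right translation x ↦ x ·_N h is not an isometry of g. -/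
noncomputable section

theorem differentiable_mulG_right (h : P) : Differentiable ℝ (fun x => mulG x h) := by
  unfold mulG Rot omegaJ
  fun_prop

theorem differentiable_mulN_right (h : P) : Differentiable ℝ (fun x => mulN x h) := by
  unfold mulN omegaJ
  fun_prop

theorem bijective_mulG_right (h : P) : Function.Bijective (fun x => mulG x h) := by
  refine Function.bijective_iff_has_inverse.mpr
    ⟨fun p => (p.1 - h.1, p.2.1 - Rot (p.1 - h.1) h.2.1,
      p.2.2 - h.2.2 - (1 / 2) * omegaJ (p.2.1 - Rot (p.1 - h.1) h.2.1)
        (Rot (p.1 - h.1) h.2.1)), fun p => ?_, fun p => ?_⟩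
  all_goals
    simp only [mulG, add_sub_cancel_right, sub_add_cancel]
    ext <;> dsimp only
    ring

theorem fderiv_mulG_right (h p u : P) :
    fderiv ℝ (fun x => mulG x h) p u =
      (u.1, (u.2.1.1 - u.1 * (Rot p.1 h.2.1).2, u.2.1.2 + u.1 * (Rot p.1 h.2.1).1),
        u.2.2 + (1 / 2) * (omegaJ u.2.1 (Rot p.1 h.2.1) +
          u.1 * (p.2.1.1 * (Rot p.1 h.2.1).1 + p.2.1.2 * (Rot p.1 h.2.1).2))) := by
  rw [← (differentiable_mulG_right h p).lineDeriv_eq_fderiv]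
  refine HasLineDerivAt.lineDeriv ?_
  have hlin (a b : ℝ) : HasDerivAt (fun s : ℝ => a + s * b) b 0 := by
    simpa using ((hasDerivAt_id (0 : ℝ)).mul_const b).const_add a
  have hc := (hlin p.1 u.1).cos
  have hs := (hlin p.1 u.1).sin
  have hw₁ := (hc.mul_const h.2.1.1).sub (hs.mul_const h.2.1.2)
  have hw₂ := (hs.mul_const h.2.1.1).add (hc.mul_const h.2.1.2)
  have hx := hlin p.2.1.1 u.2.1.1
  have hy := hlin p.2.1.2 u.2.1.2
  have hz := (((hlin p.2.2 u.2.2).add_const h.2.2)).add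
    (((hx.mul hw₂).sub (hy.mul hw₁)).const_mul (1 / 2))
  have key := ((hlin p.1 u.1).add_const h.1).prodMk
    (((hx.add hw₁).prodMk (hy.add hw₂)).prodMk hz)
  refine HasDerivAt.congr_deriv key ?_
  simp only [Rot, omegaJ, Pi.add_apply, Pi.sub_apply, zero_mul, add_zero, Prod.mk.injEq, true_and]
  refine ⟨⟨?_, ?_⟩, ?_⟩ <;> ring

theorem fderiv_mulN_right (h p u : P) :
    fderiv ℝ (fun x => mulN x h) p u =
      (u.1, u.2.1, u.2.2 + (1 / 2) * omegaJ u.2.1 h.2.1) := by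
  rw [← (differentiable_mulN_right h p).lineDeriv_eq_fderiv]
  refine HasLineDerivAt.lineDeriv ?_
  have hlin (a b : ℝ) : HasDerivAt (fun s : ℝ => a + s * b) b 0 := by
    simpa using ((hasDerivAt_id (0 : ℝ)).mul_const b).const_add a
  have hx := hlin p.2.1.1 u.2.1.1
  have hy := hlin p.2.1.2 u.2.1.2
  have hz := (((hlin p.2.2 u.2.2).add_const h.2.2)).add
    (((hx.mul_const h.2.1.2).sub (hy.mul_const h.2.1.1)).const_mul (1 / 2))
  exact ((hlin p.1 u.1).add_const h.1).prodMk
    (((hx.add_const h.2.1.1).prodMk (hy.add_const h.2.1.2)).prodMk hz)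

/-- the metric `g` is bi-invariant for `G` but not right-invariant for `N`:
every right `G`-translation is an isometry, while some right `N`-translation is not. -/
theorem g_biinvariant_G_not_right_invariant_N :
    (∀ h : P, IsIsometry (fun x => mulG x h)) ∧
    (∃ h : P, ¬ IsIsometry (fun x => mulN x h)) := by
  refine ⟨fun h => ⟨differentiable_mulG_right h, bijective_mulG_right h, fun p u w => ?_⟩,
    (0, (1, 0), 0), fun hiso => ?_⟩
  · simp only [fderiv_mulG_right]
    simp only [gmet, mulG, omegaJ, Prod.fst_add, Prod.snd_add]
    ring
  · have hdiff := hiso.2.2 (0, (0, 0), 0) (1, (0, 0), 0) (0, (0, 1), 0)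
    simp only [fderiv_mulN_right] at hdiff
    norm_num [gmet, mulN, omegaJ] at hdiff
end
end

section
/- A linear isomorphism A: 𝔤 → 𝔤 satisfies both (i) ⟨AX, AY⟩ = ⟨X, Y⟩ for all X,Y ∈ 𝔤 and (ii) A[[X,Y],Z] = [[AX,AY],AZ] for all X,Y,Z ∈ 𝔤, if and only if the matrix of A in the basis (X₀,X₁,X₂,X₃) has the block form [[ε, 0, 0],[w, Ã, 0],[−ε·½‖w‖², −ε·wᵀÃ, ε]] for some ε ∈ {1,−1}, w ∈ ℝ², and Ã ∈ O(2), where the first row/column corresponds to X₀, the middle block to span(X₁,X₂), and the last to X₃. -/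
noncomputable section

/-- Elements of the Lie algebra `𝔤`, written in coordinates w.r.t. the basis
`X₀, X₁, X₂, X₃`. -/
abbrev gV : Type := Fin 4 → ℝ

/-- The Lie bracket of `𝔤`, determined by `[X₀,X₁] = X₂`, `[X₀,X₂] = −X₁`,
`[X₁,X₂] = X₃` and all other brackets of basis elements zero. -/
def bra (a b : gV) : gV :=
  ![0, -(a 0 * b 2 - b 0 * a 2), a 0 * b 1 - b 0 * a 1, a 1 * b 2 - a 2 * b 1]

/-- The ad-invariant symmetric bilinear form with `⟨X₀,X₃⟩ = ⟨X₁,X₁⟩ = ⟨X₂,X₂⟩ = 1`. -/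
def formG (a b : gV) : ℝ := a 0 * b 3 + a 3 * b 0 + a 1 * b 1 + a 2 * b 2

open Matrix

lemma bra_bra_single_zero_one_zero :
    bra (bra (Pi.single 0 1) (Pi.single 1 1)) (Pi.single 0 1) = Pi.single 1 1 := by
  ext i
  fin_cases i <;> simp [bra]

lemma bra_bra_single_zero_two_zero :
    bra (bra (Pi.single 0 1) (Pi.single 2 1)) (Pi.single 0 1) = Pi.single 2 1 := by
  ext i
  fin_cases i <;> simp [bra]

lemma bra_bra_single_one_zero_one :
    bra (bra (Pi.single 1 1) (Pi.single 0 1)) (Pi.single 1 1) = Pi.single 3 1 := by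
  ext i
  fin_cases i <;> simp [bra]

/-- a linear isomorphism `A : 𝔤 → 𝔤` satisfies `⟨AX,AY⟩ = ⟨X,Y⟩` and
`A[[X,Y],Z] = [[AX,AY],AZ]` iff its matrix in the basis `(X₀,X₁,X₂,X₃)` has the block
form `[[ε,0,0],[w,Ã,0],[−ε·½‖w‖², −ε·wᵀÃ, ε]]` with `ε ∈ {1,−1}`, `w ∈ ℝ²`, `Ã ∈ O(2)`. -/
theorem isometry_fixing_identity_characterization (A : gV ≃ₗ[ℝ] gV) :
    ((∀ X Y : gV, formG (A X) (A Y) = formG X Y) ∧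
      (∀ X Y Z : gV, A (bra (bra X Y) Z) = bra (bra (A X) (A Y)) (A Z))) ↔
    ∃ (ε : ℝ) (w : Fin 2 → ℝ) (At : Matrix (Fin 2) (Fin 2) ℝ),
      (ε = 1 ∨ ε = -1) ∧ At.transpose * At = 1 ∧
      LinearMap.toMatrix' (A : gV →ₗ[ℝ] gV) =
        !![ε, 0, 0, 0;
           w 0, At 0 0, At 0 1, 0;
           w 1, At 1 0, At 1 1, 0;
           -ε * ((w 0 ^ 2 + w 1 ^ 2) / 2),
             -ε * (w 0 * At 0 0 + w 1 * At 1 0),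
             -ε * (w 0 * At 0 1 + w 1 * At 1 1), ε] := by
  constructor
  · rintro ⟨hform, hbra⟩
    have e00 := hform (Pi.single 0 1) (Pi.single 0 1)
    have e01 := hform (Pi.single 0 1) (Pi.single 1 1)
    have e02 := hform (Pi.single 0 1) (Pi.single 2 1)
    have e03 := hform (Pi.single 0 1) (Pi.single 3 1)
    have e11 := hform (Pi.single 1 1) (Pi.single 1 1)
    have e12 := hform (Pi.single 1 1) (Pi.single 2 1)
    have e22 := hform (Pi.single 2 1) (Pi.single 2 1)
    have b1 := hbra (Pi.single 0 1) (Pi.single 1 1) (Pi.single 0 1)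
    have b2 := hbra (Pi.single 0 1) (Pi.single 2 1) (Pi.single 0 1)
    have b3 := hbra (Pi.single 1 1) (Pi.single 0 1) (Pi.single 1 1)
    rw [bra_bra_single_zero_one_zero] at b1
    rw [bra_bra_single_zero_two_zero] at b2
    rw [bra_bra_single_one_zero_one] at b3
    have h1 : A (Pi.single 1 1) 0 = 0 := by rw [b1]; rfl
    have h2 : A (Pi.single 2 1) 0 = 0 := by rw [b2]; rfl
    have h30 : A (Pi.single 3 1) 0 = 0 := by rw [b3]; rfl
    have h31 : A (Pi.single 3 1) 1 = 0 := by rw [b3]; simp [bra, h1]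
    have h32 : A (Pi.single 3 1) 2 = 0 := by rw [b3]; simp [bra, h1]
    simp [formG, h1, h2, h30, h31, h32] at e00 e01 e02 e03 e11 e12 e22
    have h33 : A (Pi.single 3 1) 3 = A (Pi.single 0 1) 0 := by
      rw [b3]
      simp only [bra, h1, Matrix.cons_val]
      linear_combination A (Pi.single 0 1) 0 * e11
    rw [h33] at e03
    refine ⟨A (Pi.single 0 1) 0, ![A (Pi.single 0 1) 1, A (Pi.single 0 1) 2],
      !![A (Pi.single 1 1) 1, A (Pi.single 2 1) 1; A (Pi.single 1 1) 2, A (Pi.single 2 1) 2],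
      mul_self_eq_one_iff.mp e03, ?_, ?_⟩
    · ext i j
      fin_cases i <;> fin_cases j <;>
        simp [Matrix.mul_apply, Fin.sum_univ_two] <;> linarith
    · ext i j
      rw [LinearMap.toMatrix'_apply]
      fin_cases i <;> fin_cases j <;> simp [h1, h2, h30, h31, h32, h33]
      · linear_combination A (Pi.single 0 1) 0 / 2 * e00 - A (Pi.single 0 1) 3 * e03
      · linear_combination A (Pi.single 0 1) 0 * e01 - A (Pi.single 1 1) 3 * e03
      · linear_combination A (Pi.single 0 1) 0 * e02 - A (Pi.single 2 1) 3 * e03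
  · rintro ⟨ε, w, At, hε, hAt, hA⟩
    have o11 := congrFun₂ hAt 0 0
    have o12 := congrFun₂ hAt 0 1
    have o22 := congrFun₂ hAt 1 1
    simp [Matrix.mul_apply, Fin.sum_univ_two] at o11 o12 o22
    have hε2 : ε * ε = 1 := mul_self_eq_one_iff.mpr hε
    have hmul (X : gV) : A X = LinearMap.toMatrix' (A : gV →ₗ[ℝ] gV) *ᵥ X :=
      (LinearMap.toMatrix'_mulVec (A : gV →ₗ[ℝ] gV) X).symm
    have A0 (X : gV) : A X 0 = ε * X 0 := by
      rw [hmul, hA]; simp [Matrix.mulVec, dotProduct, Fin.sum_univ_four]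
    have A1 (X : gV) : A X 1 = w 0 * X 0 + At 0 0 * X 1 + At 0 1 * X 2 := by
      rw [hmul, hA]; simp [Matrix.mulVec, dotProduct, Fin.sum_univ_four]
    have A2 (X : gV) : A X 2 = w 1 * X 0 + At 1 0 * X 1 + At 1 1 * X 2 := by
      rw [hmul, hA]; simp [Matrix.mulVec, dotProduct, Fin.sum_univ_four]
    have A3 (X : gV) : A X 3 = -ε * ((w 0 ^ 2 + w 1 ^ 2) / 2) * X 0
        - ε * (w 0 * At 0 0 + w 1 * At 1 0) * X 1
        - ε * (w 0 * At 0 1 + w 1 * At 1 1) * X 2 + ε * X 3 := by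
      rw [hmul, hA]; simp [Matrix.mulVec, dotProduct, Fin.sum_univ_four]; ring
    refine ⟨fun X Y => ?_, fun X Y Z => ?_⟩
    · simp only [formG, A0, A1, A2, A3]
      rcases hε with rfl | rfl <;>
        linear_combination X 1 * Y 1 * o11 + (X 1 * Y 2 + X 2 * Y 1) * o12 + X 2 * Y 2 * o22
    · ext i
      fin_cases i
      · simp [A0, bra]
      · simp [A1, A0, A2, bra]
        linear_combination (-(Z 0 * (X 0 * (At 0 0 * Y 1 + At 0 1 * Y 2)
          - Y 0 * (At 0 0 * X 1 + At 0 1 * X 2)))) * hε2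
      · simp [A1, A0, A2, bra]
        linear_combination (-(Z 0 * (X 0 * (At 1 0 * Y 1 + At 1 1 * Y 2)
          - Y 0 * (At 1 0 * X 1 + At 1 1 * X 2)))) * hε2
      · simp [A0, A1, A2, A3, bra]
        linear_combination ε * ((X 0 * Y 1 - Y 0 * X 1) * Z 1 * o11
          + ((X 0 * Y 1 - Y 0 * X 1) * Z 2 + (X 0 * Y 2 - Y 0 * X 2) * Z 1) * o12
          + (X 0 * Y 2 - Y 0 * X 2) * Z 2 * o22)
end
end

section
/- For every X = (a₀,a₁,a₂,a₃) ∈ ℝ⁴, the curve α_X is a one-parameter subgroup of the oscillator group G with initial velocity X: α_X(0) = (0,0,0,0), α_X(s+t) = α_X(s) ·_G α_X(t) for all s,t ∈ ℝ, and the derivative of α_X at 0 equals (a₀,a₁,a₂,a₃). -/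
noncomputable section

theorem alphaG_zero (X : P) : alphaG X 0 = ((0, (0, 0), 0) : P) := by
  unfold alphaG
  split_ifs <;> simp

theorem alphaG_add (X : P) (s t : ℝ) :
    alphaG X (s + t) = mulG (alphaG X s) (alphaG X t) := by
  obtain ⟨a₀, ⟨a₁, a₂⟩, a₃⟩ := X
  by_cases h : a₀ = 0
  · simp only [alphaG, mulG, Rot, omegaJ, h, if_true, Real.cos_zero, Real.sin_zero,
      Prod.mk_add_mk, Prod.mk.injEq]
    refine ⟨?_, ⟨?_, ?_⟩, ?_⟩ <;> ring
  · have hs := Real.sin_sq_add_cos_sq (a₀ * s)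
    simp only [alphaG, mulG, Rot, omegaJ, h, if_false, mul_add, Real.cos_add, Real.sin_add,
      Prod.mk_add_mk, Prod.mk.injEq]
    refine ⟨trivial, ⟨by ring, by ring⟩, ?_⟩
    generalize Real.sin (a₀ * s) = S at *
    generalize Real.cos (a₀ * s) = C at *
    generalize Real.sin (a₀ * t) = S' at *
    generalize Real.cos (a₀ * t) = C' at *
    linear_combination (-(1 / 2) * (a₁ ^ 2 + a₂ ^ 2) / a₀ ^ 2 * S') * hs

theorem hasDerivAt_alphaG_zero (X : P) : HasDerivAt (alphaG X) X 0 := by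
  obtain ⟨a₀, ⟨a₁, a₂⟩, a₃⟩ := X
  have hlin (c : ℝ) : HasDerivAt (fun s : ℝ => c * s) c 0 := by
    simpa using (hasDerivAt_id (0 : ℝ)).const_mul c
  by_cases h : a₀ = 0
  · subst h
    have hα : alphaG (0, (a₁, a₂), a₃) = fun s => (0, (a₁ * s, a₂ * s), a₃ * s) := by
      funext s
      simp [alphaG]
    rw [hα]
    exact (hasDerivAt_const _ _).prodMk (((hlin a₁).prodMk (hlin a₂)).prodMk (hlin a₃))
  · have hsin : HasDerivAt (fun s : ℝ => Real.sin (a₀ * s)) a₀ 0 := by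
      simpa using (hlin a₀).sin
    have hcos : HasDerivAt (fun s : ℝ => Real.cos (a₀ * s)) 0 0 := by
      simpa using (hlin a₀).cos
    have hx := ((hsin.const_mul (a₁ / a₀)).add (hcos.const_mul (a₂ / a₀))).sub_const (a₂ / a₀)
    have hy := ((hcos.const_mul (-(a₁ / a₀))).add (hsin.const_mul (a₂ / a₀))).add_const (a₁ / a₀)
    have hz := ((hlin ((a₁ ^ 2 + a₂ ^ 2) / a₀ + 2 * a₃)).sub
      (hsin.const_mul ((a₁ ^ 2 + a₂ ^ 2) / a₀ ^ 2))).const_mul (1 / 2)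
    convert (hlin a₀).prodMk ((hx.prodMk hy).prodMk hz) using 1
    · funext s
      simp [alphaG, h]
    · simp only [Prod.mk.injEq]
      refine ⟨trivial, ⟨?_, ?_⟩, ?_⟩ <;> field_simp <;> ring

/-- for every `X = (a₀,a₁,a₂,a₃) ∈ ℝ⁴`, the curve `α_X` is a one-parameter
subgroup of the oscillator group `G` with initial velocity `X`. -/
theorem alphaG_one_parameter_subgroup (X : P) :
    alphaG X 0 = ((0, (0, 0), 0) : P) ∧
    (∀ s t : ℝ, alphaG X (s + t) = mulG (alphaG X s) (alphaG X t)) ∧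
    HasDerivAt (alphaG X) X 0 := by
  exact ⟨alphaG_zero X, alphaG_add X, hasDerivAt_alphaG_zero X⟩
end
end

section
/- For every positive integer k, each of the sets Λ_{k,0} = 2πℤ×ℤ×ℤ×(1/(2k))ℤ, Λ_{k,π} = πℤ×ℤ×ℤ×(1/(2k))ℤ, and Λ_{k,π/2} = (π/2)ℤ×ℤ×ℤ×(1/(2k))ℤ is a lattice of the oscillator group G: it is a subgroup of G, it is discrete as a subset of ℝ⁴, and it is cocompact, i.e. there is a compact set C ⊆ ℝ⁴ with ⋃_{λ∈Λ} λ ·_G C = ℝ⁴. -/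
noncomputable section

lemma exists_int_cos_sin_pi_div_two_mul (n : ℤ) :
    ∃ c s : ℤ, Real.cos (Real.pi / 2 * n) = c ∧ Real.sin (Real.pi / 2 * n) = s := by
  induction n using Int.induction_on with
  | zero => exact ⟨1, 0, by simp, by simp⟩
  | succ n ih =>
    obtain ⟨c, s, hc, hs⟩ := ih
    refine ⟨-s, c, ?_, ?_⟩ <;> push_cast at * <;> rw [mul_add, mul_one]
    · rw [Real.cos_add_pi_div_two, hs]
    · rw [Real.sin_add_pi_div_two, hc]
  | pred n ih =>
    obtain ⟨c, s, hc, hs⟩ := ih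
    refine ⟨s, -c, ?_, ?_⟩ <;> push_cast at * <;> rw [mul_sub, mul_one]
    · rw [Real.cos_sub_pi_div_two, hs]
    · rw [Real.sin_sub_pi_div_two, hc]

lemma exists_int_cos_sin_mul {θ : ℝ}
    (hθ : θ ∈ ({2 * Real.pi, Real.pi, Real.pi / 2} : Set ℝ)) (m : ℤ) :
    ∃ c s : ℤ, Real.cos (θ * m) = c ∧ Real.sin (θ * m) = s := by
  obtain ⟨j, rfl⟩ : ∃ j : ℤ, θ = Real.pi / 2 * j := by
    rcases hθ with rfl | rfl | rfl
    · exact ⟨4, by push_cast; ring⟩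
    · exact ⟨2, by push_cast; ring⟩
    · exact ⟨1, by simp⟩
  have h := exists_int_cos_sin_pi_div_two_mul (j * m)
  rwa [Int.cast_mul, ← mul_assoc] at h

lemma isSubgroupG_Lam {k : ℕ} (hk : 0 < k) {θ : ℝ}
    (hθ : ∀ m : ℤ, ∃ c s : ℤ, Real.cos (θ * m) = c ∧ Real.sin (θ * m) = s) :
    IsSubgroupG (Lam θ k) := by
  have hk' : (k : ℝ) ≠ 0 := by positivity
  refine ⟨⟨⟨0, by simp⟩, ⟨0, by simp⟩, ⟨0, by simp⟩, ⟨0, by simp⟩⟩, ?_, ?_⟩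
  · rintro ⟨t, ⟨x, y⟩, z⟩ ⟨⟨m, hm⟩, ⟨a, ha⟩, ⟨b, hb⟩, ⟨n, hn⟩⟩
      ⟨t', ⟨x', y'⟩, z'⟩ ⟨⟨m', hm'⟩, ⟨a', ha'⟩, ⟨b', hb'⟩, ⟨n', hn'⟩⟩
    dsimp only at *
    subst hm ha hb hn hm' ha' hb' hn'
    obtain ⟨c, s, hc, hs⟩ := hθ m
    refine ⟨⟨m + m', ?_⟩, ⟨a + (c * a' - s * b'), ?_⟩, ⟨b + (s * a' + c * b'), ?_⟩,
      ⟨n + n' + k * (a * (s * a' + c * b') - b * (c * a' - s * b')), ?_⟩⟩ <;>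
      simp only [mulG, Rot, omegaJ, hc, hs, Prod.fst_add, Prod.snd_add] <;> push_cast
    · ring
    · ring
    · ring
    · field_simp
  · rintro ⟨t, ⟨x, y⟩, z⟩ ⟨⟨m, hm⟩, ⟨a, ha⟩, ⟨b, hb⟩, ⟨n, hn⟩⟩
    dsimp only at *
    subst hm ha hb hn
    obtain ⟨c, s, hc, hs⟩ := hθ m
    refine ⟨⟨-m, ?_⟩, ⟨-(c * a + s * b), ?_⟩, ⟨-(-s * a + c * b), ?_⟩, ⟨-n, ?_⟩⟩ <;>
      simp only [invG, Rot, Real.cos_neg, Real.sin_neg, hc, hs, Prod.fst_neg, Prod.snd_neg] <;>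
      push_cast <;> ring

lemma Int.eq_of_dist_mul_lt {d : ℝ} (hd : 0 < d) {m n : ℤ} (h : dist (d * m) (d * n) < d) :
    m = n := by
  rw [Real.dist_eq, ← mul_sub, abs_mul, abs_of_pos hd, mul_lt_iff_lt_one_right hd] at h
  have h' : |m - n| < 1 := by exact_mod_cast h
  exact sub_eq_zero.mp (Int.abs_lt_one_iff.mp h')

lemma Lam_discrete {k : ℕ} (hk : 0 < k) {θ : ℝ} (hθ : 0 < θ) :
    ∀ p ∈ Lam θ k, ∃ ε > (0 : ℝ), ∀ q ∈ Lam θ k, dist q p < ε → q = p := by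
  have hk' : (0 : ℝ) < (2 * k : ℝ)⁻¹ := by positivity
  rintro ⟨t, ⟨x, y⟩, z⟩ ⟨⟨m, hm⟩, ⟨a, ha⟩, ⟨b, hb⟩, ⟨n, hn⟩⟩
  refine ⟨min θ (min 1 (2 * k : ℝ)⁻¹), by positivity, ?_⟩
  rintro ⟨t', ⟨x', y'⟩, z'⟩ ⟨⟨m', hm'⟩, ⟨a', ha'⟩, ⟨b', hb'⟩, ⟨n', hn'⟩⟩ h
  simp only [Prod.dist_eq, max_lt_iff] at h
  simp only [lt_min_iff] at h
  dsimp only at *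
  subst hm ha hb hn hm' ha' hb' hn'
  obtain ⟨⟨ht, -⟩, ⟨⟨-, hx, -⟩, -, hy, -⟩, -, -, hz⟩ := h
  rw [div_eq_inv_mul, div_eq_inv_mul] at hz
  obtain rfl : a' = a := Int.eq_of_dist_mul_lt one_pos (by simpa only [one_mul] using hx)
  obtain rfl : b' = b := Int.eq_of_dist_mul_lt one_pos (by simpa only [one_mul] using hy)
  rw [Int.eq_of_dist_mul_lt hθ ht, Int.eq_of_dist_mul_lt hk' hz]

lemma abs_mul_add_mul_le_two {a b u v : ℝ} (ha : |a| ≤ 1) (hb : |b| ≤ 1) (hu : |u| ≤ 1)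
    (hv : |v| ≤ 1) : |a * u + b * v| ≤ 2 := by
  calc |a * u + b * v| ≤ |a| * |u| + |b| * |v| := by
        rw [← abs_mul, ← abs_mul]; exact abs_add_le _ _
    _ ≤ 1 * 1 + 1 * 1 := by gcongr
    _ = 2 := by norm_num

lemma abs_fract_le_one (x : ℝ) : |Int.fract x| ≤ 1 := by
  rw [Int.abs_fract]; exact (Int.fract_lt_one x).le

lemma Rot_Rot_neg (t : ℝ) (v : ℝ × ℝ) : Rot t (Rot (-t) v) = v := by
  have h := Real.sin_sq_add_cos_sq t
  ext <;> simp only [Rot, Real.cos_neg, Real.sin_neg]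
  · linear_combination v.1 * h
  · linear_combination v.2 * h

/-- Every real is within `[0, d]` of an integer multiple of `d` below it. -/
lemma exists_int_sub_mul_mem_Icc {d : ℝ} (hd : 0 < d) (x : ℝ) :
    ∃ m : ℤ, x - d * m ∈ Set.Icc 0 d := by
  refine ⟨⌊x / d⌋, ?_, ?_⟩
  · have := (le_div_iff₀ hd).mp (Int.floor_le (x / d))
    linarith
  · have := (div_lt_iff₀ hd).mp (Int.lt_floor_add_one (x / d))
    linarith

lemma Lam_cocompact {k : ℕ} (hk : 0 < k) {θ : ℝ} (hθ : 0 < θ) :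
    ∃ C : Set P, IsCompact C ∧ (⋃ l ∈ Lam θ k, (fun c => mulG l c) '' C) = Set.univ := by
  refine ⟨Set.Icc 0 θ ×ˢ (Set.Icc (-2) 2 ×ˢ Set.Icc (-2) 2) ×ˢ Set.Icc 0 (2 * k : ℝ)⁻¹,
    isCompact_Icc.prod ((isCompact_Icc.prod isCompact_Icc).prod isCompact_Icc), ?_⟩
  refine Set.eq_univ_of_forall ?_
  rintro ⟨t, ⟨x, y⟩, z⟩
  obtain ⟨m, hm⟩ := exists_int_sub_mul_mem_Icc hθ t
  let f : ℝ × ℝ := (Int.fract x, Int.fract y)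
  let w : ℝ := 1 / 2 * omegaJ (⌊x⌋, ⌊y⌋) f
  have hk' : (0 : ℝ) < (2 * k : ℝ)⁻¹ := by positivity
  obtain ⟨n, hn⟩ := exists_int_sub_mul_mem_Icc hk' (z - w)
  have hc := Real.abs_cos_le_one (-(θ * m))
  have hs := Real.abs_sin_le_one (-(θ * m))
  have hx := abs_fract_le_one x
  have hy := abs_fract_le_one y
  refine Set.mem_iUnion₂.mpr ⟨(θ * m, (⌊x⌋, ⌊y⌋), n / (2 * k)),
    ⟨⟨m, rfl⟩, ⟨_, rfl⟩, ⟨_, rfl⟩, ⟨n, rfl⟩⟩,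
    (t - θ * m, Rot (-(θ * m)) f, z - w - (2 * k : ℝ)⁻¹ * n),
    ⟨hm, ⟨abs_le.mp ?_, abs_le.mp ?_⟩, hn⟩, ?_⟩
  · have h := abs_mul_add_mul_le_two hc ((abs_neg _).trans_le hs) hx hy
    rw [neg_mul, ← sub_eq_add_neg] at h
    exact h
  · exact abs_mul_add_mul_le_two hs hc hx hy
  · simp only [mulG, Rot_Rot_neg, Prod.mk.injEq]
    refine ⟨by ring, ?_, ?_⟩
    · ext <;> simp [f]
    · change _ + w = z
      ring

/-- for every positive integer `k`, each of `Λ_{k,0}`, `Λ_{k,π}`,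
`Λ_{k,π/2}` is a lattice of the oscillator group `G`: a subgroup which is discrete as a
subset of `ℝ⁴` and cocompact. -/
theorem Lam_is_lattice (k : ℕ) (hk : 0 < k)
    (θ : ℝ) (hθ : θ ∈ ({2 * Real.pi, Real.pi, Real.pi / 2} : Set ℝ)) :
    IsSubgroupG (Lam θ k) ∧
    (∀ p ∈ Lam θ k, ∃ ε > (0 : ℝ), ∀ q ∈ Lam θ k, dist q p < ε → q = p) ∧
    (∃ C : Set P, IsCompact C ∧ (⋃ l ∈ Lam θ k, (fun c => mulG l c) '' C) = Set.univ) := by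
  have hpos : 0 < θ := by
    rcases hθ with rfl | rfl | rfl <;> positivity
  exact ⟨isSubgroupG_Lam hk (exists_int_cos_sin_mul hθ), Lam_discrete hk hpos,
    Lam_cocompact hk hpos⟩
end
end

section
/- For every positive integer k, Λ_{k,0} is a normal subgroup of Λ_{k,π}, and Λ_{k,π} is a normal subgroup of Λ_{k,π/2}, where all three are subgroups of the oscillator group G. -/
noncomputable section

lemma exists_int_cos_sin (m : ℤ) :
    ∃ c s : ℤ, Real.cos (Real.pi / 2 * m) = c ∧ Real.sin (Real.pi / 2 * m) = s := by
  induction m using Int.induction_on with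
  | zero => exact ⟨1, 0, by simp⟩
  | succ n ih =>
    obtain ⟨c, s, hc, hs⟩ := ih
    refine ⟨-s, c, ?_⟩
    push_cast at hc hs ⊢
    rw [mul_add, mul_one, Real.cos_add_pi_div_two, Real.sin_add_pi_div_two, hc, hs]
    exact ⟨rfl, rfl⟩
  | pred n ih =>
    obtain ⟨c, s, hc, hs⟩ := ih
    refine ⟨s, -c, ?_⟩
    push_cast at hc hs ⊢
    rw [mul_sub, mul_one, Real.cos_sub_pi_div_two, Real.sin_sub_pi_div_two, hc, hs]
    exact ⟨rfl, rfl⟩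

lemma mulG_mem_Lam {k : ℕ} (hk : 0 < k) {a b : P} (ha : a ∈ Lam (Real.pi / 2) k)
    (hb : b ∈ Lam (Real.pi / 2) k) : mulG a b ∈ Lam (Real.pi / 2) k := by
  obtain ⟨⟨m, hm⟩, ⟨x, hx⟩, ⟨y, hy⟩, z, hz⟩ := ha
  obtain ⟨⟨m', hm'⟩, ⟨x', hx'⟩, ⟨y', hy'⟩, z', hz'⟩ := hb
  obtain ⟨c, s, hc, hs⟩ := exists_int_cos_sin m
  have hk' : (k : ℝ) ≠ 0 := by positivity
  refine ⟨⟨m + m', ?_⟩, ⟨x + (c * x' - s * y'), ?_⟩, ⟨y + (s * x' + c * y'), ?_⟩,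
    z + z' + k * (x * (s * x' + c * y') - y * (c * x' - s * y')), ?_⟩
  · simp only [mulG, hm, hm']
    push_cast
    ring
  · simp [mulG, Rot, hm, hx, hx', hy', hc, hs]
  · simp [mulG, Rot, hm, hy, hx', hy', hc, hs]
  · simp only [mulG, Rot, omegaJ, hm, hx, hy, hz, hx', hy', hz', hc, hs]
    push_cast
    field_simp

lemma invG_mem_Lam {k : ℕ} {a : P} (ha : a ∈ Lam (Real.pi / 2) k) :
    invG a ∈ Lam (Real.pi / 2) k := by
  obtain ⟨⟨m, hm⟩, ⟨x, hx⟩, ⟨y, hy⟩, z, hz⟩ := ha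
  obtain ⟨c, s, hc, hs⟩ := exists_int_cos_sin m
  refine ⟨⟨-m, ?_⟩, ⟨-(c * x + s * y), ?_⟩, ⟨-(-s * x + c * y), ?_⟩, -z, ?_⟩
  · simp [invG, hm]
  · simp [invG, Rot, hm, hx, hy, hc, hs]
  · simp [invG, Rot, hm, hx, hy, hc, hs]
  · simp [invG, hz, neg_div]

lemma Lam_mul_natCast_subset (θ : ℝ) (n k : ℕ) : Lam (θ * n) k ⊆ Lam θ k := by
  rintro a ⟨⟨m, hm⟩, h⟩
  exact ⟨⟨n * m, by rw [hm]; push_cast; ring⟩, h⟩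

lemma isSubgroupG_Lam_s11 {k : ℕ} (hk : 0 < k) (n : ℕ) :
    IsSubgroupG (Lam (Real.pi / 2 * n) k) := by
  have hsub := Lam_mul_natCast_subset (Real.pi / 2) n k
  refine ⟨⟨⟨0, by simp⟩, ⟨0, by simp⟩, ⟨0, by simp⟩, 0, by simp⟩, fun a ha b hb => ?_,
    fun a ha => ?_⟩
  · refine ⟨?_, (mulG_mem_Lam hk (hsub ha) (hsub hb)).2⟩
    obtain ⟨m, hm⟩ := ha.1
    obtain ⟨m', hm'⟩ := hb.1
    exact ⟨m + m', by simp only [mulG, hm, hm']; push_cast; ring⟩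
  · refine ⟨?_, (invG_mem_Lam (hsub ha)).2⟩
    obtain ⟨m, hm⟩ := ha.1
    exact ⟨-m, by simp [invG, hm]⟩

lemma conjG_fst (g x : P) : (conjG g x).1 = x.1 := by
  simp [conjG, mulG, invG]

lemma conjG_mem_Lam {k : ℕ} (hk : 0 < k) (n : ℕ) {g x : P} (hg : g ∈ Lam (Real.pi / 2) k)
    (hx : x ∈ Lam (Real.pi / 2 * n) k) : conjG g x ∈ Lam (Real.pi / 2 * n) k := by
  refine ⟨?_, (mulG_mem_Lam hk (mulG_mem_Lam hk hg (Lam_mul_natCast_subset _ n k hx))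
    (invG_mem_Lam hg)).2⟩
  rw [conjG_fst]
  exact hx.1

/-- `Λ_{k,0} ⊴ Λ_{k,π} ⊴ Λ_{k,π/2}` as subgroups of the oscillator
group `G`. -/
theorem Lam_normal_chain (k : ℕ) (hk : 0 < k) :
    IsSubgroupG (Lam (2 * Real.pi) k) ∧ IsSubgroupG (Lam Real.pi k) ∧
    IsSubgroupG (Lam (Real.pi / 2) k) ∧
    Lam (2 * Real.pi) k ⊆ Lam Real.pi k ∧
    (∀ γ ∈ Lam Real.pi k, ∀ x ∈ Lam (2 * Real.pi) k, conjG γ x ∈ Lam (2 * Real.pi) k) ∧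
    Lam Real.pi k ⊆ Lam (Real.pi / 2) k ∧
    (∀ γ ∈ Lam (Real.pi / 2) k, ∀ x ∈ Lam Real.pi k, conjG γ x ∈ Lam Real.pi k) := by
  have h₁ : Real.pi / 2 = Real.pi / 2 * (1 : ℕ) := by simp
  have h₂ : Real.pi = Real.pi / 2 * (2 : ℕ) := by push_cast; ring
  have h₄ : 2 * Real.pi = Real.pi / 2 * (4 : ℕ) := by push_cast; ring
  have hsub : Lam Real.pi k ⊆ Lam (Real.pi / 2) k := by
    simpa only [← h₂] using Lam_mul_natCast_subset (Real.pi / 2) 2 k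
  refine ⟨?_, ?_, ?_, ?_, fun γ hγ x hx => ?_, hsub, fun γ hγ x hx => ?_⟩
  · simpa only [← h₄] using isSubgroupG_Lam_s11 hk 4
  · simpa only [← h₂] using isSubgroupG_Lam_s11 hk 2
  · simpa only [← h₁] using isSubgroupG_Lam_s11 hk 1
  · simpa [mul_comm] using Lam_mul_natCast_subset Real.pi 2 k
  · rw [h₄] at hx ⊢
    exact conjG_mem_Lam hk 4 (hsub hγ) hx
  · have := conjG_mem_Lam hk 2 hγ (x := x)
    rw [← h₂] at this
    exact this hx
end
end

section
/- Let k be a positive integer and X = (a₀,a₁,a₂,a₃) ∈ ℝ⁴ with a₀ ≠ 0. For T ∈ ℝ, the one-parameter subgroup α_X of G satisfies α_X(T) ∈ Λ_{k,0} if and only if a₀T ∈ 2πℤ and ((a₁²+a₂²+2a₀a₃)/(2a₀))·T ∈ (1/(2k))ℤ. -/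
noncomputable section

/-- for `X = (a₀,a₁,a₂,a₃)` with `a₀ ≠ 0`, one has `α_X(T) ∈ Λ_{k,0}` iff
`a₀T ∈ 2πℤ` and `((a₁² + a₂² + 2a₀a₃)/(2a₀))·T ∈ (1/(2k))ℤ`. -/
theorem alphaG_mem_Lam_zero_iff (k : ℕ) (hk : 0 < k) (X : P) (h0 : X.1 ≠ 0) (T : ℝ) :
    alphaG X T ∈ Lam (2 * Real.pi) k ↔
      (∃ m : ℤ, X.1 * T = 2 * Real.pi * m) ∧
      (∃ m : ℤ, ((X.2.1.1 ^ 2 + X.2.1.2 ^ 2 + 2 * X.1 * X.2.2) / (2 * X.1)) * T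
          = m / (2 * k)) := by
  have hz : (1 / 2) * (((X.2.1.1 ^ 2 + X.2.1.2 ^ 2) / X.1 + 2 * X.2.2) * T)
      = ((X.2.1.1 ^ 2 + X.2.1.2 ^ 2 + 2 * X.1 * X.2.2) / (2 * X.1)) * T := by
    field_simp
  simp only [Lam, alphaG, if_neg h0, Set.mem_ofPred_eq]
  refine and_congr_right ?_
  rintro ⟨m, hm⟩
  have hm' : X.1 * T = m * (2 * Real.pi) := by rw [hm, mul_comm]
  have hcos : Real.cos (X.1 * T) = 1 := by rw [hm', Real.cos_int_mul_two_pi]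
  have hsin : Real.sin (X.1 * T) = 0 := by
    rw [hm', ← zero_add ((m : ℝ) * (2 * Real.pi)), Real.sin_add_int_mul_two_pi, Real.sin_zero]
  simp only [hcos, hsin, mul_zero, mul_one, zero_add, add_zero, sub_zero, sub_self,
    neg_add_cancel, hz]
  have h : ∃ n : ℤ, (0 : ℝ) = n := ⟨0, by simp⟩
  simp only [h, true_and]
end
end

section
/- Every lightlike geodesic on the compact quotients of the oscillator group by the lattices Λ_{k,0}, Λ_{k,π}, Λ_{k,π/2} is periodic: for every positive integer k, every Λ ∈ {Λ_{k,0}, Λ_{k,π}, Λ_{k,π/2}}, every h ∈ G, and every nonzero X = (a₀,a₁,a₂,a₃) ∈ ℝ⁴ with a₁²+a₂²+2a₀a₃ = 0, there exists T ≠ 0 such that for all s ∈ ℝ, (h ·_G α_X(s+T)) ·_G (h ·_G α_X(s))⁻¹ ∈ Λ (equivalently, the projection of the geodesic s ↦ h ·_G α_X(s) to Λ\G is periodic with period T). -/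
noncomputable section

theorem Rot_neg_Rot_neg {τ : ℝ} (hτ : Real.cos τ = 1) (t : ℝ) (v : ℝ × ℝ) :
    Rot (τ + t) (-Rot (-t) v) = -v := by
  have hs : Real.sin τ = 0 := Real.sin_eq_zero_iff_cos_eq.mpr (Or.inl hτ)
  have h := Real.sin_sq_add_cos_sq t
  ext
  · simp only [Rot, Real.cos_add, Real.sin_add, hτ, hs, Real.cos_neg, Real.sin_neg,
      Prod.fst_neg, Prod.snd_neg]
    linear_combination -v.1 * h
  · simp only [Rot, Real.cos_add, Real.sin_add, hτ, hs, Real.cos_neg, Real.sin_neg,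
      Prod.fst_neg, Prod.snd_neg]
    linear_combination -v.2 * h

/-- `(τ, 0, ζ)` is central in `G` when `τ` is a full turn: translating `a` by it
translates `h · a` by the same element. -/
theorem mulG_translate_mulG_invG {τ : ℝ} (hτ : Real.cos τ = 1) (ζ : ℝ) (h a : P) :
    mulG (mulG h (τ + a.1, a.2.1, ζ + a.2.2)) (invG (mulG h a)) = (τ, (0, 0), ζ) := by
  have hshift : mulG h (τ + a.1, a.2.1, ζ + a.2.2)
      = (τ + (mulG h a).1, (mulG h a).2.1, ζ + (mulG h a).2.2) := by
    simp only [mulG, Prod.mk.injEq]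
    exact ⟨by ring, trivial, by ring⟩
  rw [hshift]
  generalize mulG h a = p
  simp only [mulG, invG, Rot_neg_Rot_neg hτ, omegaJ, Prod.fst_neg, Prod.snd_neg, Prod.mk.injEq]
  exact ⟨by ring, add_neg_cancel p.2.1, by ring⟩

theorem alphaG_add_of_fst_eq_zero {X : P} (h₀ : X.1 = 0) (hv : X.2.1 = 0) (s T : ℝ) :
    alphaG X (s + T)
      = (0 + (alphaG X s).1, (alphaG X s).2.1, X.2.2 * T + (alphaG X s).2.2) := by
  simp [alphaG, h₀, hv]
  ring

theorem alphaG_add_two_pi_div {X : P} (h₀ : X.1 ≠ 0)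
    (hnull : X.2.1.1 ^ 2 + X.2.1.2 ^ 2 + 2 * X.1 * X.2.2 = 0) (s : ℝ) :
    alphaG X (s + 2 * Real.pi / X.1)
      = (2 * Real.pi + (alphaG X s).1, (alphaG X s).2.1, 0 + (alphaG X s).2.2) := by
  have harg : X.1 * (s + 2 * Real.pi / X.1) = X.1 * s + 2 * Real.pi := by
    field_simp
  have hslope : (X.2.1.1 ^ 2 + X.2.1.2 ^ 2) / X.1 + 2 * X.2.2 = 0 := by
    field_simp
    linarith
  simp only [alphaG, if_neg h₀, harg, hslope, Real.sin_add_two_pi, Real.cos_add_two_pi,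
    Prod.mk.injEq, true_and]
  exact ⟨by ring, by ring⟩

theorem exists_two_pi_eq_mul {θ : ℝ}
    (hθ : θ ∈ ({2 * Real.pi, Real.pi, Real.pi / 2} : Set ℝ)) :
    ∃ m : ℤ, 2 * Real.pi = θ * m := by
  rcases hθ with rfl | rfl | rfl
  · exact ⟨1, by push_cast; ring⟩
  · exact ⟨2, by push_cast; ring⟩
  · exact ⟨4, by push_cast; ring⟩

/-- every lightlike geodesic on the compact quotients `Λ\G` is periodic:
for every lattice `Λ ∈ {Λ_{k,0}, Λ_{k,π}, Λ_{k,π/2}}`, every `h ∈ G` and every nonzero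
lightlike `X`, there is `T ≠ 0` with `(h ·_G α_X(s+T)) ·_G (h ·_G α_X(s))⁻¹ ∈ Λ` for
all `s`. -/
theorem lightlike_geodesics_periodic (k : ℕ) (hk : 0 < k)
    (θ : ℝ) (hθ : θ ∈ ({2 * Real.pi, Real.pi, Real.pi / 2} : Set ℝ))
    (h X : P) (hX : X ≠ ((0, (0, 0), 0) : P))
    (hnull : X.2.1.1 ^ 2 + X.2.1.2 ^ 2 + 2 * X.1 * X.2.2 = 0) :
    ∃ T : ℝ, T ≠ 0 ∧ ∀ s : ℝ,
      mulG (mulG h (alphaG X (s + T))) (invG (mulG h (alphaG X s))) ∈ Lam θ k := by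
  by_cases h₀ : X.1 = 0
  · rw [h₀] at hnull
    have hv : X.2.1 = 0 := by
      ext <;> simp only [Prod.fst_zero, Prod.snd_zero] <;> nlinarith
    have h₃ : X.2.2 ≠ 0 := fun h₃ => hX (Prod.ext h₀ (Prod.ext hv h₃))
    have hk' : (k : ℝ) ≠ 0 := by positivity
    refine ⟨1 / (2 * k * X.2.2), by positivity, fun s => ?_⟩
    rw [alphaG_add_of_fst_eq_zero h₀ hv, mulG_translate_mulG_invG Real.cos_zero]
    refine ⟨⟨0, by simp⟩, ⟨0, by simp⟩, ⟨0, by simp⟩, 1, ?_⟩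
    push_cast
    field_simp
  · refine ⟨2 * Real.pi / X.1, div_ne_zero Real.two_pi_pos.ne' h₀, fun s => ?_⟩
    rw [alphaG_add_two_pi_div h₀ hnull, mulG_translate_mulG_invG Real.cos_two_pi]
    exact ⟨exists_two_pi_eq_mul hθ, ⟨0, by simp⟩, ⟨0, by simp⟩, 0, by simp⟩
end
end

section
/- On each compact quotient of the oscillator group there are closed and non-closed spacelike and timelike geodesics: for every positive integer k and every Λ ∈ {Λ_{k,0}, Λ_{k,π}, Λ_{k,π/2}}, (1) there exists a spacelike X (a₁²+a₂²+2a₀a₃ > 0) with α_X(T) ∈ Λ for some T ≠ 0, (2) there exists a spacelike X with α_X(T) ∉ Λ for every T ≠ 0, (3) there exists a timelike X (a₁²+a₂²+2a₀a₃ < 0) with α_X(T) ∈ Λ for some T ≠ 0, and (4) there exists a timelike X with α_X(T) ∉ Λ for every T ≠ 0. -/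
noncomputable section

/-- A geodesic through the identity with zero `ℝ²`-component is a straight line. -/
theorem alphaG_axis {a : ℝ} (ha : a ≠ 0) (c s : ℝ) :
    alphaG (a, (0, 0), c) s = (a * s, (0, 0), c * s) := by
  simp only [alphaG, if_neg ha]
  ext <;> simp
  ring

/-- The axial geodesic with integral slope meets the lattice at parameter `1`. -/
theorem alphaG_axis_int_mem_Lam {θ : ℝ} (hθ : θ ≠ 0) {k : ℕ} (hk : 0 < k) (c : ℤ) :
    alphaG (θ, (0, 0), c) 1 ∈ Lam θ k := by
  have hk' : (k : ℝ) ≠ 0 := by positivity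
  rw [alphaG_axis hθ]
  refine ⟨⟨1, by simp⟩, ⟨0, by simp⟩, ⟨0, by simp⟩, c * (2 * k), ?_⟩
  push_cast
  field_simp

/-- The axial geodesic with irrational slope meets the lattice only at the identity. -/
theorem alphaG_axis_irrational_notMem_Lam {θ : ℝ} (hθ : θ ≠ 0) (k : ℕ) {c : ℝ}
    (hc : Irrational c) {T : ℝ} (hT : T ≠ 0) :
    alphaG (θ, (0, 0), c) T ∉ Lam θ k := by
  rw [alphaG_axis hθ]
  rintro ⟨⟨m, hm⟩, -, -, n, hn⟩
  obtain rfl : T = m := mul_left_cancel₀ hθ hm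
  have hm0 : m ≠ 0 := by exact_mod_cast hT
  exact (hc.mul_intCast hm0).ne_rat (n / (2 * k) : ℚ) (by push_cast; exact hn)

/-- on each compact quotient `Λ\G` there are closed and non-closed
spacelike and timelike geodesics. -/
theorem spacelike_timelike_closed_and_nonclosed (k : ℕ) (hk : 0 < k)
    (θ : ℝ) (hθ : θ ∈ ({2 * Real.pi, Real.pi, Real.pi / 2} : Set ℝ)) :
    (∃ X : P, X.2.1.1 ^ 2 + X.2.1.2 ^ 2 + 2 * X.1 * X.2.2 > 0 ∧
      ∃ T : ℝ, T ≠ 0 ∧ alphaG X T ∈ Lam θ k) ∧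
    (∃ X : P, X.2.1.1 ^ 2 + X.2.1.2 ^ 2 + 2 * X.1 * X.2.2 > 0 ∧
      ∀ T : ℝ, T ≠ 0 → alphaG X T ∉ Lam θ k) ∧
    (∃ X : P, X.2.1.1 ^ 2 + X.2.1.2 ^ 2 + 2 * X.1 * X.2.2 < 0 ∧
      ∃ T : ℝ, T ≠ 0 ∧ alphaG X T ∈ Lam θ k) ∧
    (∃ X : P, X.2.1.1 ^ 2 + X.2.1.2 ^ 2 + 2 * X.1 * X.2.2 < 0 ∧
      ∀ T : ℝ, T ≠ 0 → alphaG X T ∉ Lam θ k) := by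
  have hpos : 0 < θ := by
    rcases hθ with rfl | rfl | rfl <;> positivity
  have hsqrt : 0 < Real.sqrt 2 := by positivity
  refine ⟨⟨(θ, (0, 0), (1 : ℤ)), ?_, 1, one_ne_zero, alphaG_axis_int_mem_Lam hpos.ne' hk 1⟩,
    ⟨(θ, (0, 0), Real.sqrt 2), ?_, fun T hT =>
      alphaG_axis_irrational_notMem_Lam hpos.ne' k irrational_sqrt_two hT⟩,
    ⟨(θ, (0, 0), (-1 : ℤ)), ?_, 1, one_ne_zero, alphaG_axis_int_mem_Lam hpos.ne' hk (-1)⟩,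
    ⟨(θ, (0, 0), -Real.sqrt 2), ?_, fun T hT =>
      alphaG_axis_irrational_notMem_Lam hpos.ne' k irrational_sqrt_two.neg hT⟩⟩
  · simpa using hpos
  · simpa using hpos
  · simpa using hpos
  · simpa using mul_pos hpos hsqrt
end
end

section
/- The Killing form of the Lie algebra 𝔤 satisfies B(X,Y) = −2 a₀ b₀ for X = a₀X₀+a₁X₁+a₂X₂+a₃X₃ and Y = b₀X₀+b₁X₁+b₂X₂+b₃X₃, where B(X,Y) = tr(ad(X) ∘ ad(Y)); consequently the Ricci tensor Ric = −¼B of the bi-invariant metric satisfies Ric(X,X) = ½ a₀² ≥ 0. -/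
noncomputable section

/-- The matrix of `ad(X) : Y ↦ [X,Y]` in the basis `(X₀,X₁,X₂,X₃)`, for
`X = a₀X₀ + a₁X₁ + a₂X₂ + a₃X₃`. -/
def adMat (a : gV) : Matrix (Fin 4) (Fin 4) ℝ :=
  !![0, 0, 0, 0;
     a 2, 0, -(a 0), 0;
     -(a 1), a 0, 0, 0;
     0, -(a 2), a 1, 0]

/-- The trace of `ad X ∘ ad Y` in coordinates. -/
theorem trace_ad_comp_ad (a b : gV) :
    LinearMap.trace ℝ gV (Matrix.toLin' (adMat a) ∘ₗ Matrix.toLin' (adMat b))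
      = -2 * a 0 * b 0 := by
  rw [← Matrix.toLin'_mul, Matrix.trace_toLin'_eq]
  simp [Matrix.trace, Fin.sum_univ_four, adMat]
  ring

/-- the Killing form satisfies `B(X,Y) = tr(ad X ∘ ad Y) = −2a₀b₀`;
consequently `Ric(X,X) = −¼B(X,X) = ½a₀² ≥ 0`. -/
theorem killing_form_eq (a b : gV) :
    (∀ c : gV, Matrix.toLin' (adMat a) c = bra a c) ∧
    LinearMap.trace ℝ gV (Matrix.toLin' (adMat a) ∘ₗ Matrix.toLin' (adMat b))
      = -2 * a 0 * b 0 ∧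
    -(1 / 4) * LinearMap.trace ℝ gV (Matrix.toLin' (adMat a) ∘ₗ Matrix.toLin' (adMat a))
      = (1 / 2) * a 0 ^ 2 ∧
    (0 : ℝ) ≤ (1 / 2) * a 0 ^ 2 := by
  refine ⟨fun c => ?_, trace_ad_comp_ad a b, ?_, by positivity⟩
  · ext i
    fin_cases i <;>
      simp [Matrix.mulVec, dotProduct, Fin.sum_univ_four, adMat, bra] <;> ring
  · rw [trace_ad_comp_ad]
    ring
end
end
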